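/- For every ε > 0 there exists an equiareal quilt of total area smaller than ε: a finite collection 𝓡 of distinct dyadic rectangles in [0,1)², all of the same Lebesgue area, with Σ_{R∈𝓡} |R| = 1, such that Σ_{R∈𝓡, R⊆Q} |R| ≤ |Q| for every dyadic rectangle Q, and |⋃_{R∈𝓡} R| < ε. -/

import Mathlib

open MeasureTheory
open scoped BigOperators ENNReal Classical

noncomputable section

/-- `R ⊆ ℝ²` is a dyadic rectangle in `[0,1)²`: a product of two dyadic
intervals `[j/2^N, (j+1)/2^N) ⊆ [0,1)`. -/
def IsDyadicRect (R : Set (ℝ × ℝ)) : Prop :=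
  ∃ N₁ j₁ N₂ j₂ : ℕ, j₁ < 2 ^ N₁ ∧ j₂ < 2 ^ N₂ ∧
    R = Set.Ico ((j₁ : ℝ) / 2 ^ N₁) ((j₁ + 1 : ℝ) / 2 ^ N₁) ×ˢ
        Set.Ico ((j₂ : ℝ) / 2 ^ N₂) ((j₂ + 1 : ℝ) / 2 ^ N₂)

/-- The binary words of length `n`. -/
def words (n : ℕ) : Finset (List Bool) :=
  (Finset.univ : Finset (List.Vector Bool n)).image List.Vector.toList

theorem mem_words {n : ℕ} {l : List Bool} : l ∈ words n ↔ l.length = n := by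
  rw [words, Finset.mem_image]
  exact ⟨fun ⟨v, _, hv⟩ => hv ▸ v.toList_length, fun h => ⟨⟨l, h⟩, Finset.mem_univ _, rfl⟩⟩

theorem card_words (n : ℕ) : (words n).card = 2 ^ n := by
  rw [words, Finset.card_image_of_injective _ List.Vector.toList_injective, Finset.card_univ,
    card_vector, Fintype.card_bool]

/-- The number of words of length `n` satisfying `P`. -/
def wordCount (P : List Bool → Prop) (n : ℕ) : ℕ := ((words n).filter P).card

theorem wordCount_reverse (P : List Bool → Prop) (n : ℕ) :
    wordCount (fun l => P l.reverse) n = wordCount P n := by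
  apply Finset.card_bij (fun l _ => l.reverse)
  · intro l hl
    simpa [mem_words] using hl
  · intro a _ b _ h
    exact List.reverse_injective h
  · intro b hb
    exact ⟨b.reverse, by simpa [mem_words] using hb, by simp⟩

theorem wordCount_succ_le_of_append {P : List Bool → Prop} (hP : ∀ a b, P (a ++ b) → P a) (n : ℕ) :
    wordCount P (n + 1) ≤ 2 * wordCount P n := by
  have h : wordCount P (n + 1) ≤
      (((words n).filter P) ×ˢ (words 1)).card := by
    apply Finset.card_le_card_of_injOn (fun l => (l.take n, l.drop n))
    · intro l hl
      simp only [Finset.coe_filter, mem_words, Set.mem_ofPred_eq] at hl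
      simp only [Finset.coe_product, Set.mem_prod, Finset.mem_coe, Finset.mem_filter, mem_words,
        List.length_take, List.length_drop]
      refine ⟨⟨by omega, hP (l.take n) (l.drop n) (by simpa using hl.2)⟩, by omega⟩
    · intro a _ b _ hab
      simp only [Prod.mk.injEq] at hab
      rw [← List.take_append_drop n a, ← List.take_append_drop n b, hab.1, hab.2]
  rw [Finset.card_product, card_words] at h
  simp only [wordCount] at *
  omega

/-- The `k`-th hybrid of `X` and `Y` is admissible: its `X`-part satisfies `U`, its `Y`-part `V`. -/
def Hit (U V : List Bool → Prop) (X Y : List Bool) (k : ℕ) : Prop := U (X.take k) ∧ V (Y.drop k)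

/-- The pairs of words of length `N` whose first hit is at `k`. -/
def firstHit (U V : List Bool → Prop) (N k : ℕ) : Finset (List Bool × List Bool) :=
  (words N ×ˢ words N).filter fun p => Hit U V p.1 p.2 k ∧ ∀ i < k, ¬ Hit U V p.1 p.2 i

theorem card_firstHit_mul_le {U V : List Bool → Prop} (hU : ∀ a b, U a → U b → U (a ++ b))
    (hV : ∀ a b, V a → V b → V (a ++ b)) (hV' : ∀ a b, V (a ++ b) → V a) {N k j : ℕ}
    (hkj : k + j ≤ N) :
    (firstHit U V N k).card * (wordCount U j * wordCount V j) ≤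
      4 ^ j * ((firstHit U V N k).filter fun p => Hit U V p.1 p.2 (k + j)).card := by
  have key : (firstHit U V N k ×ˢ ((words j).filter U ×ˢ (words j).filter V)).card ≤
      ((words j ×ˢ words j) ×ˢ
        ((firstHit U V N k).filter fun p => Hit U V p.1 p.2 (k + j))).card := by
    apply Finset.card_le_card_of_injOn (fun q =>
      (((q.1.1.drop k).take j, q.1.2.drop (N - j)),
        (q.1.1.take k ++ (q.2.1 ++ (q.1.1.drop k).drop j),
          q.1.2.take k ++ (q.2.2 ++ (q.1.2.drop k).take (N - k - j)))))
    · rintro ⟨⟨X, Y⟩, ⟨p, q⟩⟩ h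
      simp only [Finset.coe_product, Set.mem_prod, Finset.mem_coe, Finset.mem_filter,
        firstHit, Finset.mem_product, mem_words] at h ⊢
      obtain ⟨⟨⟨hX, hY⟩, ⟨hUX, hVY⟩, hfirst⟩, ⟨hp, hUp⟩, hq, hVq⟩ := h
      have hXk : (X.take k).length = k := by simp; omega
      have hYk : (Y.take k).length = k := by simp; omega
      have hVt : V ((Y.drop k).take (N - k - j)) :=
        hV' _ ((Y.drop k).drop (N - k - j)) (by rwa [List.take_append_drop])
      refine ⟨⟨by simp; omega, by simp; omega⟩, ⟨⟨by simp; omega, by simp; omega⟩, ⟨?_, ?_⟩, ?_⟩,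
        ?_, ?_⟩
      · rwa [List.take_left' hXk]
      · rw [List.drop_left' hYk]
        exact hV _ _ hVq hVt
      · rintro i hi ⟨h1, h2⟩
        refine hfirst i hi ⟨?_, ?_⟩
        · rw [List.take_append_of_le_length (by omega), List.take_take] at h1
          rwa [min_eq_left hi.le] at h1
        · rw [List.drop_append_of_le_length (by omega)] at h2
          have := hV _ _ (hV' _ _ h2) hVY
          rwa [← List.drop_append_of_le_length (by omega), List.take_append_drop] at this
      · rw [← List.append_assoc, List.take_left' (by simp; omega)]
        exact hU _ _ hUX hUp
      · rw [← List.append_assoc, List.drop_left' (by simp; omega)]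
        exact hVt
    · rintro ⟨⟨X, Y⟩, ⟨p, q⟩⟩ h ⟨⟨X', Y'⟩, ⟨p', q'⟩⟩ h' heq
      simp only [Finset.coe_product, Set.mem_prod, Finset.mem_coe, Finset.mem_filter,
        firstHit, Finset.mem_product, mem_words] at h h'
      obtain ⟨⟨⟨hX, hY⟩, -⟩, ⟨hp, -⟩, hq, -⟩ := h
      obtain ⟨⟨⟨hX', hY'⟩, -⟩, ⟨hp', -⟩, hq', -⟩ := h'
      simp only [Prod.mk.injEq] at heq
      obtain ⟨⟨e1, e2⟩, e3, e4⟩ := heq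
      obtain ⟨e5, e6⟩ := List.append_inj e3 (by simp; omega)
      obtain ⟨e7, e8⟩ := List.append_inj e6 (by omega)
      obtain ⟨e9, e10⟩ := List.append_inj e4 (by simp; omega)
      obtain ⟨e11, e12⟩ := List.append_inj e10 (by omega)
      have eX : X = X' := by
        rw [← List.take_append_drop k X, ← List.take_append_drop k X', e5,
          ← List.take_append_drop j (X.drop k), e1, e8, List.take_append_drop]
      have e13 : (Y.drop k).drop (N - k - j) = (Y'.drop k).drop (N - k - j) := by
        rw [List.drop_drop, List.drop_drop, show k + (N - k - j) = N - j by omega, e2]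
      have eY : Y = Y' := by
        rw [← List.take_append_drop k Y, ← List.take_append_drop k Y', e9,
          ← List.take_append_drop (N - k - j) (Y.drop k), e12, e13, List.take_append_drop]
      rw [eX, eY, e7, e11]
  simp only [Finset.card_product, card_words] at key
  have e : 4 ^ j = 2 ^ j * 2 ^ j := by rw [← mul_pow]; norm_num
  rw [e]
  exact key

theorem card_exists_hit_mul_le {U V : List Bool → Prop} (hU : ∀ a b, U a → U b → U (a ++ b))
    (hV : ∀ a b, V a → V b → V (a ++ b)) (hV' : ∀ a b, V (a ++ b) → V a) (M : ℕ) :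
    (((words (2 * M) ×ˢ words (2 * M)).filter fun p => ∃ k ≤ M, Hit U V p.1 p.2 k).card : ℝ) *
        ∑ j ∈ Finset.range (M + 1), (wordCount U j / 2 ^ j : ℝ) * (wordCount V j / 2 ^ j) ≤
      ∑ k ∈ Finset.range (2 * M + 1),
        (((words (2 * M) ×ˢ words (2 * M)).filter fun p => Hit U V p.1 p.2 k).card : ℝ) := by
  set W := words (2 * M) ×ˢ words (2 * M) with hW
  have hdisj : ∀ s : Finset ℕ, (s : Set ℕ).PairwiseDisjoint (firstHit U V (2 * M)) := by
    intro s a _ b _ hab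
    refine Finset.disjoint_left.2 fun p ha hb => ?_
    simp only [firstHit, Finset.mem_filter] at ha hb
    rcases lt_or_gt_of_ne hab with h | h
    · exact hb.2.2 _ h ha.2.1
    · exact ha.2.2 _ h hb.2.1
  have hunion : W.filter (fun p => ∃ k ≤ M, Hit U V p.1 p.2 k) ⊆
      (Finset.range (M + 1)).biUnion (firstHit U V (2 * M)) := by
    intro p hp
    rw [Finset.mem_filter] at hp
    obtain ⟨hpW, k, hk, hit⟩ := hp
    have hex : ∃ k, Hit U V p.1 p.2 k := ⟨k, hit⟩
    refine Finset.mem_biUnion.2 ⟨Nat.find hex, ?_, ?_⟩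
    · have := Nat.find_min' hex hit
      simp only [Finset.mem_range]; omega
    · exact Finset.mem_filter.2 ⟨hpW, Nat.find_spec hex, fun i hi => Nat.find_min hex hi⟩
  have hcard : ((W.filter fun p => ∃ k ≤ M, Hit U V p.1 p.2 k).card : ℝ) ≤
      ∑ k ∈ Finset.range (M + 1), ((firstHit U V (2 * M) k).card : ℝ) := by
    exact_mod_cast (Finset.card_le_card hunion).trans Finset.card_biUnion_le
  have hstep : ∀ k ∈ Finset.range (M + 1), ∀ j ∈ Finset.range (M + 1),
      ((firstHit U V (2 * M) k).card : ℝ) *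
        ((wordCount U j / 2 ^ j : ℝ) * (wordCount V j / 2 ^ j)) ≤
      (((firstHit U V (2 * M) k).filter fun p => Hit U V p.1 p.2 (k + j)).card : ℝ) := by
    intro k hk j hj
    rw [Finset.mem_range] at hk hj
    have h := card_firstHit_mul_le hU hV hV' (N := 2 * M) (k := k) (j := j) (by omega)
    have h' : ((firstHit U V (2 * M) k).card : ℝ) * (wordCount U j * wordCount V j) ≤
      4 ^ j * (((firstHit U V (2 * M) k).filter fun p => Hit U V p.1 p.2 (k + j)).card : ℝ) := by
      exact_mod_cast h
    have e : (4 : ℝ) ^ j = 2 ^ j * 2 ^ j := by rw [← mul_pow]; norm_num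
    rw [div_mul_div_comm, ← e, ← mul_div_assoc, div_le_iff₀ (by positivity)]
    linarith
  have hinner : ∀ k ∈ Finset.range (M + 1),
      ∑ j ∈ Finset.range (M + 1),
        (((firstHit U V (2 * M) k).filter fun p => Hit U V p.1 p.2 (k + j)).card : ℝ) ≤
      ∑ i ∈ Finset.range (2 * M + 1),
        (((firstHit U V (2 * M) k).filter fun p => Hit U V p.1 p.2 i).card : ℝ) := by
    intro k hk
    rw [Finset.mem_range] at hk
    rw [← Finset.sum_image (s := Finset.range (M + 1)) (g := fun j => k + j)
      (f := fun i => (((firstHit U V (2 * M) k).filter fun p => Hit U V p.1 p.2 i).card : ℝ))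
      (fun a _ b _ h => by simpa using h)]
    apply Finset.sum_le_sum_of_subset_of_nonneg
    · intro i hi
      simp only [Finset.mem_image, Finset.mem_range] at hi ⊢
      obtain ⟨a, ha, rfl⟩ := hi
      omega
    · intros; positivity
  calc _ ≤ (∑ k ∈ Finset.range (M + 1), ((firstHit U V (2 * M) k).card : ℝ)) *
        ∑ j ∈ Finset.range (M + 1), (wordCount U j / 2 ^ j : ℝ) * (wordCount V j / 2 ^ j) := by
        gcongr
    _ ≤ ∑ k ∈ Finset.range (M + 1), ∑ i ∈ Finset.range (2 * M + 1),
        (((firstHit U V (2 * M) k).filter fun p => Hit U V p.1 p.2 i).card : ℝ) := by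
        rw [Finset.sum_mul]
        refine Finset.sum_le_sum fun k hk => (le_trans ?_ (hinner k hk))
        rw [Finset.mul_sum]
        exact Finset.sum_le_sum (hstep k hk)
    _ ≤ _ := by
        rw [Finset.sum_comm]
        refine Finset.sum_le_sum fun i _ => ?_
        norm_cast
        rw [← Finset.card_biUnion]
        · apply Finset.card_le_card
          intro p hp
          simp only [Finset.mem_biUnion, Finset.mem_filter, firstHit] at hp ⊢
          obtain ⟨k, -, h1, h2⟩ := hp
          exact ⟨h1.1, h2⟩
        · intro a ha b hb hab
          exact Finset.disjoint_filter_filter (hdisj _ ha hb hab)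

theorem card_hit_reverse (U V : List Bool → Prop) (N : ℕ) (S T : ℕ → Prop)
    (hST : ∀ k ≤ N, S k → T (N - k)) (hS : ∀ k, S k → k ≤ N) :
    ((words N ×ˢ words N).filter fun p => ∃ k, S k ∧ Hit U V p.1 p.2 k).card ≤
      ((words N ×ˢ words N).filter fun p => ∃ k, T k ∧
        Hit (fun l => V l.reverse) (fun l => U l.reverse) p.1 p.2 k).card := by
  apply Finset.card_le_card_of_injOn (fun p => (p.2.reverse, p.1.reverse))
  · rintro ⟨X, Y⟩ h
    simp only [Finset.coe_filter, Finset.mem_product, mem_words, Set.mem_ofPred_eq] at h ⊢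
    obtain ⟨⟨hX, hY⟩, k, hk, h1, h2⟩ := h
    have := hS k hk
    refine ⟨by simp [hX, hY], N - k, hST k this hk, ?_, ?_⟩
    · dsimp only
      rw [List.take_reverse, List.reverse_reverse, hY, show N - (N - k) = k by omega]
      exact h2
    · dsimp only
      rw [List.drop_reverse, List.reverse_reverse, hX, show N - (N - k) = k by omega]
      exact h1
  · rintro ⟨X, Y⟩ _ ⟨X', Y'⟩ _ h
    simp only [Prod.mk.injEq, List.reverse_inj] at h
    rw [h.1, h.2]

theorem card_exists_hit_mul_le_two_mul {U V : List Bool → Prop}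
    (hU : ∀ a b, U a → U b → U (a ++ b)) (hU' : ∀ a b, U (a ++ b) → U b)
    (hV : ∀ a b, V a → V b → V (a ++ b)) (hV' : ∀ a b, V (a ++ b) → V a) (M : ℕ) :
    (((words (2 * M) ×ˢ words (2 * M)).filter fun p =>
          ∃ k ≤ 2 * M, Hit U V p.1 p.2 k).card : ℝ) *
        ∑ j ∈ Finset.range (M + 1), (wordCount U j / 2 ^ j : ℝ) * (wordCount V j / 2 ^ j) ≤
      2 * ∑ k ∈ Finset.range (2 * M + 1),
        (((words (2 * M) ×ˢ words (2 * M)).filter fun p => Hit U V p.1 p.2 k).card : ℝ) := by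
  have h1 := card_exists_hit_mul_le hU hV hV' M
  have h2 := card_exists_hit_mul_le (U := fun l => V l.reverse) (V := fun l => U l.reverse)
    (fun a b ha hb => by rw [List.reverse_append]; exact hV _ _ hb ha)
    (fun a b ha hb => by rw [List.reverse_append]; exact hU _ _ hb ha)
    (fun a b hab => by rw [List.reverse_append] at hab; exact hU' _ _ hab) M
  simp only [wordCount_reverse] at h2
  set W := words (2 * M) ×ˢ words (2 * M) with hW
  have h3 : ∑ k ∈ Finset.range (2 * M + 1), ((W.filter fun p =>
      Hit (fun l => V l.reverse) (fun l => U l.reverse) p.1 p.2 k).card : ℝ) ≤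
      ∑ k ∈ Finset.range (2 * M + 1), ((W.filter fun p => Hit U V p.1 p.2 k).card : ℝ) := by
    rw [← Finset.sum_range_reflect (fun k => ((W.filter fun p => Hit U V p.1 p.2 k).card : ℝ))]
    refine Finset.sum_le_sum fun k hk => ?_
    rw [Finset.mem_range] at hk
    have := card_hit_reverse (fun l => V l.reverse) (fun l => U l.reverse) (2 * M)
      (fun i => i = k) (fun i => i = 2 * M + 1 - 1 - k) (by rintro i _ rfl; omega)
      (by rintro i rfl; omega)
    simp only [List.reverse_reverse, exists_eq_left] at this
    exact_mod_cast this
  have h4 := card_hit_reverse U V (2 * M) (fun k => M ≤ k ∧ k ≤ 2 * M) (fun k => k ≤ M)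
    (by intro k hk h; omega) (fun k h => h.2)
  rw [← hW] at h4
  have h5 : (W.filter fun p => ∃ k ≤ 2 * M, Hit U V p.1 p.2 k) ⊆
      (W.filter fun p => ∃ k ≤ M, Hit U V p.1 p.2 k) ∪
      (W.filter fun p => ∃ k, (M ≤ k ∧ k ≤ 2 * M) ∧ Hit U V p.1 p.2 k) := by
    intro p hp
    simp only [Finset.mem_union, Finset.mem_filter] at hp ⊢
    obtain ⟨hpW, k, hk, h⟩ := hp
    rcases le_total k M with h' | h'
    · exact Or.inl ⟨hpW, k, h', h⟩
    · exact Or.inr ⟨hpW, k, ⟨h', hk⟩, h⟩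
  have h6 := (Finset.card_le_card h5).trans (Finset.card_union_le _ _)
  have h7 : ((W.filter fun p => ∃ k ≤ 2 * M, Hit U V p.1 p.2 k).card : ℝ) ≤
      ((W.filter fun p => ∃ k ≤ M, Hit U V p.1 p.2 k).card : ℝ) +
      ((W.filter fun p => ∃ k ≤ M,
        Hit (fun l => V l.reverse) (fun l => U l.reverse) p.1 p.2 k).card : ℝ) := by
    norm_cast
    refine (h6.trans (Nat.add_le_add_left h4 _)).trans (le_of_eq ?_)
    congr!
  have h8 : ∑ j ∈ Finset.range (M + 1), (wordCount V j / 2 ^ j : ℝ) * (wordCount U j / 2 ^ j) =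
      ∑ j ∈ Finset.range (M + 1), (wordCount U j / 2 ^ j : ℝ) * (wordCount V j / 2 ^ j) :=
    Finset.sum_congr rfl fun _ _ => mul_comm _ _
  rw [h8] at h2
  have h9 : (0 : ℝ) ≤ ∑ j ∈ Finset.range (M + 1),
      (wordCount U j / 2 ^ j : ℝ) * (wordCount V j / 2 ^ j) :=
    Finset.sum_nonneg fun _ _ => by positivity
  nlinarith [mul_le_mul_of_nonneg_right h7 h9]

/-- The endpoint of the `±1` walk coded by a binary word. -/
def height (l : List Bool) : ℤ := (l.map fun b => if b then 1 else -1).sum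

theorem height_append (a b : List Bool) : height (a ++ b) = height a + height b := by
  simp [height]

/-- The walk attains a strict record at its endpoint. -/
def IsAscending (l : List Bool) : Prop := ∀ a b, l = a ++ b → b ≠ [] → 0 < height b

/-- The walk never goes above its starting point. -/
def IsLow (l : List Bool) : Prop := ∀ a b, l = a ++ b → height a ≤ 0

theorem IsAscending.append {u v : List Bool} (hu : IsAscending u) (hv : IsAscending v) :
    IsAscending (u ++ v) := by
  intro a b h hb
  rcases List.append_eq_append_iff.1 h with ⟨c, rfl, rfl⟩ | ⟨c, rfl, rfl⟩
  · exact hv _ _ rfl hb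
  · rw [height_append]
    by_cases hc : c = []
    · subst hc
      rw [List.nil_append] at hb
      simpa [height] using hv [] _ rfl hb
    · have h1 := hu _ _ rfl hc
      by_cases hv0 : v = []
      · subst hv0; simpa [height] using h1
      · have := hv [] _ rfl hv0
        omega

theorem IsAscending.of_append {u v : List Bool} (h : IsAscending (u ++ v)) : IsAscending v := by
  rintro a b rfl hb
  exact h (u ++ a) b (by simp) hb

theorem IsLow.append {u v : List Bool} (hu : IsLow u) (hv : IsLow v) : IsLow (u ++ v) := by
  intro a b h
  rcases List.append_eq_append_iff.1 h with ⟨c, rfl, rfl⟩ | ⟨c, rfl, rfl⟩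
  · have h1 := hu u [] (by simp)
    have h2 := hv _ _ rfl
    rw [height_append]
    omega
  · exact hu _ _ rfl

theorem IsLow.of_append {u v : List Bool} (h : IsLow (u ++ v)) : IsLow u := by
  rintro a b rfl
  exact h a (b ++ v) (by simp)

theorem exists_isAscending_isLow (w : List Bool) :
    ∃ u v, w = u ++ v ∧ IsAscending u ∧ IsLow v := by
  induction w with
  | nil => exact ⟨[], [], rfl, fun a b h hb => by simp_all, fun a b h => by simp_all [height]⟩
  | cons b w ih =>
    obtain ⟨u, v, rfl, hu, hv⟩ := ih
    by_cases h : 0 < height (b :: u)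
    · refine ⟨b :: u, v, rfl, ?_, hv⟩
      intro c d hcd hd
      rcases c with _ | ⟨c0, c⟩
      · rw [List.nil_append] at hcd
        rwa [← hcd]
      · rw [List.cons_append, List.cons.injEq] at hcd
        exact hu _ _ hcd.2 hd
    · refine ⟨[], (b :: u) ++ v, rfl, fun a b h hb => by simp_all, IsLow.append ?_ hv⟩
      intro c d hcd
      rcases eq_or_ne c [] with rfl | hc
      · simp [height]
      rcases eq_or_ne d [] with rfl | hd
      · rw [List.append_nil] at hcd
        rw [← hcd]
        omega
      · rcases c with _ | ⟨c0, c⟩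
        · exact absurd rfl hc
        · have := hcd
          rw [List.cons_append, List.cons.injEq] at this
          have h1 := hu _ _ this.2 hd
          rw [hcd, height_append] at h
          omega

theorem IsAscending.length_le {u v u' v' : List Bool} (h : u ++ v = u' ++ v')
    (hv : IsLow v) (hu' : IsAscending u') : u'.length ≤ u.length := by
  rcases List.append_eq_append_iff.1 h with ⟨c, rfl, rfl⟩ | ⟨c, rfl, rfl⟩
  · by_cases hc : c = []
    · simp [hc]
    · have h1 := hu' _ _ rfl hc
      have h2 := hv _ _ rfl
      omega
  · simp

theorem height_reverse_map_not (l : List Bool) : height (l.map not).reverse = -height l := by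
  rw [height, List.map_reverse, List.sum_reverse]
  induction l with
  | nil => simp [height]
  | cons b l ih =>
    simp only [height, List.map_cons, List.sum_cons] at ih ⊢
    rw [ih]
    cases b <;> simp <;> ring

theorem reverse_map_not_append (a b : List Bool) : ((a ++ b).map not).reverse =
    (b.map not).reverse ++ (a.map not).reverse := by simp

theorem reverse_map_not_involutive (l : List Bool) :
    ((l.map not).reverse.map not).reverse = l := by
  simp [Function.comp_def]

theorem reverse_map_not_eq {l m : List Bool} (h : (l.map not).reverse = m) :
    l = (m.map not).reverse := by
  rw [← h, reverse_map_not_involutive]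

theorem IsAscending.isLow_reverse_map_not {l : List Bool} (h : IsAscending l) :
    IsLow (l.map not).reverse := by
  intro a b hab
  have h1 := reverse_map_not_eq hab
  rw [reverse_map_not_append] at h1
  by_cases ha : a = []
  · simp [ha, height]
  · have := h _ _ h1 (by simpa using ha)
    rw [height_reverse_map_not] at this
    omega

theorem IsLow.isAscending_reverse_map_not_append {l : List Bool} (h : IsLow l) :
    IsAscending ((l.map not).reverse ++ [true]) := by
  intro a b hab hb
  rcases List.append_eq_append_iff.1 hab with ⟨c, rfl, hc⟩ | ⟨c, hl, rfl⟩
  · rcases List.singleton_eq_append_iff.1 hc with ⟨rfl, rfl⟩ | ⟨rfl, rfl⟩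
    · simp [height]
    · exact absurd rfl hb
  · have h1 := reverse_map_not_eq hl
    rw [reverse_map_not_append] at h1
    have := h _ _ h1
    rw [height_reverse_map_not] at this
    rw [height_append]
    have : height [true] = 1 := by simp [height]
    omega

theorem reverse_map_not_injective : Function.Injective fun l : List Bool => (l.map not).reverse :=
  Function.Involutive.injective reverse_map_not_involutive

theorem wordCount_isAscending_le (n : ℕ) : wordCount IsAscending n ≤ wordCount IsLow n := by
  apply Finset.card_le_card_of_injOn (fun l => (l.map not).reverse)
  · intro l hl
    simp only [Finset.coe_filter, mem_words, Set.mem_ofPred_eq] at hl ⊢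
    exact ⟨by simpa using hl.1, hl.2.isLow_reverse_map_not⟩
  · exact reverse_map_not_injective.injOn

theorem wordCount_isLow_le (n : ℕ) : wordCount IsLow n ≤ wordCount IsAscending (n + 1) := by
  apply Finset.card_le_card_of_injOn (fun l => (l.map not).reverse ++ [true])
  · intro l hl
    simp only [Finset.coe_filter, mem_words, Set.mem_ofPred_eq] at hl ⊢
    exact ⟨by simpa using hl.1, hl.2.isAscending_reverse_map_not_append⟩
  · intro a _ b _ h
    exact reverse_map_not_injective (List.append_cancel_right h)

theorem wordCount_isLow_le_two_mul (n : ℕ) :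
    wordCount IsLow n ≤ 2 * wordCount IsAscending n := by
  refine (wordCount_isLow_le n).trans ?_
  have := wordCount_succ_le_of_append (P := fun l => IsAscending l.reverse)
    (fun a b h => by rw [List.reverse_append] at h; exact h.of_append) n
  rwa [wordCount_reverse, wordCount_reverse] at this

theorem two_pow_le_sum_wordCount (N : ℕ) :
    2 ^ N ≤ ∑ k ∈ Finset.range (N + 1), wordCount IsAscending k * wordCount IsLow (N - k) := by
  have h : words N ⊆ (Finset.range (N + 1)).biUnion fun k =>
      (((words k).filter IsAscending) ×ˢ ((words (N - k)).filter IsLow)).image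
        fun p => p.1 ++ p.2 := by
    intro w hw
    rw [mem_words] at hw
    obtain ⟨u, v, rfl, hu, hv⟩ := exists_isAscending_isLow w
    rw [List.length_append] at hw
    refine Finset.mem_biUnion.2 ⟨u.length, Finset.mem_range.2 (by omega),
      Finset.mem_image.2 ⟨(u, v), ?_, rfl⟩⟩
    simp only [Finset.mem_product, Finset.mem_filter, mem_words]
    exact ⟨⟨trivial, hu⟩, by omega, hv⟩
  rw [← card_words N]
  refine (Finset.card_le_card h).trans (Finset.card_biUnion_le.trans ?_)
  refine Finset.sum_le_sum fun k _ => Finset.card_image_le.trans ?_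
  rw [Finset.card_product]
  rfl

theorem not_summable_sq_of_one_le_convolution {b : ℕ → ℝ} (h0 : ∀ n, 0 ≤ b n) (h1 : ∀ n, b n ≤ 1)
    (hconv : ∀ N, 1 ≤ ∑ k ∈ Finset.range (N + 1), b k * b (N - k)) :
    ¬ Summable fun n => b n ^ 2 := by
  intro hs
  obtain ⟨J, hJ⟩ := ((tendsto_sum_nat_add fun n => b n ^ 2).eventually_lt_const
    (show (0 : ℝ) < 1 / 4 by norm_num)).exists
  set δ : ℝ := 1 / (8 * (J + 1)) with hδ
  have hδ0 : 0 < δ := by positivity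
  have hJδ : J * δ ≤ 1 / 8 := by
    rw [hδ, mul_one_div, div_le_div_iff₀ (by positivity) (by norm_num)]
    linarith
  obtain ⟨N₀, hN₀⟩ := Filter.eventually_atTop.1
    (hs.tendsto_atTop_zero.eventually_lt_const (show (0 : ℝ) < δ ^ 2 by positivity))
  have hb : ∀ n, N₀ ≤ n → b n ≤ δ := fun n hn =>
    (lt_of_pow_lt_pow_left₀ 2 hδ0.le (hN₀ n hn)).le
  set N := N₀ + 2 * J with hN
  let g : ℕ → ℝ := fun k => if k < J then δ else b k ^ 2 / 2
  have hg0 : ∀ k, 0 ≤ g k := fun k => by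
    simp only [g]; split_ifs <;> positivity
  have hle : ∀ k ∈ Finset.range (N + 1), b k * b (N - k) ≤ g k + g (N - k) := by
    intro k hk
    rw [Finset.mem_range] at hk
    rcases lt_or_ge k J with hkJ | hkJ
    · have e : g k = δ := if_pos hkJ
      have := hb (N - k) (by omega)
      nlinarith [h0 k, h1 k, h0 (N - k), hg0 (N - k)]
    · rcases lt_or_ge (N - k) J with hkJ' | hkJ'
      · have e : g (N - k) = δ := if_pos hkJ'
        have := hb k (by omega)
        nlinarith [h0 k, h1 (N - k), h0 (N - k), hg0 k]
      · have e : g k = b k ^ 2 / 2 := if_neg (by omega)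
        have e' : g (N - k) = b (N - k) ^ 2 / 2 := if_neg (by omega)
        nlinarith [sq_nonneg (b k - b (N - k))]
  have hrefl : ∑ k ∈ Finset.range (N + 1), g (N - k) = ∑ k ∈ Finset.range (N + 1), g k := by
    simpa using Finset.sum_range_reflect g (N + 1)
  have hsum : ∑ k ∈ Finset.range (N + 1), g k ≤ 1 / 4 := by
    rw [show N + 1 = J + (N₀ + J + 1) by omega, Finset.sum_range_add]
    have e1 : ∑ k ∈ Finset.range J, g k = J * δ := by
      rw [Finset.sum_congr rfl fun k hk => if_pos (Finset.mem_range.1 hk)]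
      simp
    have e2 : ∑ k ∈ Finset.range (N₀ + J + 1), g (J + k) =
        (∑ k ∈ Finset.range (N₀ + J + 1), b (k + J) ^ 2) / 2 := by
      rw [Finset.sum_div]
      refine Finset.sum_congr rfl fun k _ => ?_
      rw [add_comm k J]
      exact if_neg (by omega)
    have e3 := ((summable_nat_add_iff J).2 hs).sum_le_tsum (Finset.range (N₀ + J + 1))
      fun _ _ => sq_nonneg _
    linarith
  have := (hconv N).trans (Finset.sum_le_sum hle)
  rw [Finset.sum_add_distrib, hrefl] at this
  linarith

theorem wordCount_le (P : List Bool → Prop) (n : ℕ) : wordCount P n ≤ 2 ^ n := by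
  rw [← card_words n]
  exact Finset.card_filter_le _ _

theorem tendsto_sum_wordCount_mul : Filter.Tendsto (fun M => ∑ j ∈ Finset.range M,
    (wordCount IsAscending j / 2 ^ j : ℝ) * (wordCount IsLow j / 2 ^ j))
    Filter.atTop Filter.atTop := by
  rw [← not_summable_iff_tendsto_nat_atTop_of_nonneg fun _ => by positivity]
  intro hs
  refine not_summable_sq_of_one_le_convolution (b := fun n => (wordCount IsLow n / 2 ^ n : ℝ))
    (fun n => by positivity) (fun n => ?_) (fun N => ?_) ?_
  · rw [div_le_one (by positivity)]
    exact_mod_cast wordCount_le _ n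
  · have h : ((2 : ℝ) ^ N) ≤ ∑ k ∈ Finset.range (N + 1),
        (wordCount IsAscending k * wordCount IsLow (N - k) : ℝ) := by
      exact_mod_cast two_pow_le_sum_wordCount N
    rw [← div_le_div_iff_of_pos_right (c := (2 : ℝ) ^ N) (by positivity),
      div_self (by positivity), Finset.sum_div] at h
    refine h.trans (Finset.sum_le_sum fun k hk => ?_)
    rw [Finset.mem_range] at hk
    have e : (2 : ℝ) ^ N = 2 ^ k * 2 ^ (N - k) := by rw [← pow_add]; congr 1; omega
    rw [e, ← div_mul_div_comm]
    have := wordCount_isAscending_le k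
    gcongr
  · refine Summable.of_nonneg_of_le (fun _ => sq_nonneg _) (fun n => ?_) (hs.mul_left 2)
    have h : (wordCount IsLow n : ℝ) ≤ 2 * wordCount IsAscending n := by
      exact_mod_cast wordCount_isLow_le_two_mul n
    have h' : (wordCount IsLow n / 2 ^ n : ℝ) ≤ 2 * (wordCount IsAscending n / 2 ^ n) := by
      rw [← mul_div_assoc]
      gcongr
    rw [sq, ← mul_assoc]
    gcongr

theorem sum_card_hit_le (N : ℕ) : ∑ k ∈ Finset.range (N + 1),
    ((words N ×ˢ words N).filter fun p => Hit IsAscending IsLow p.1 p.2 k).card ≤ 4 ^ N := by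
  have h4 : 4 ^ N = (words N ×ˢ words N).card := by
    rw [Finset.card_product, card_words, ← mul_pow]; norm_num
  rw [h4, ← Finset.card_sigma]
  apply Finset.card_le_card_of_injOn
    (fun q => (q.2.1.take q.1 ++ q.2.2.drop q.1, q.2.2.take q.1 ++ q.2.1.drop q.1))
  · rintro ⟨k, X, Y⟩ h
    simp only [Finset.coe_sigma, Set.mem_sigma_iff, Finset.mem_coe, Finset.mem_filter,
      Finset.mem_product, mem_words, Finset.mem_range] at h ⊢
    constructor <;> simp <;> omega
  · rintro ⟨k, X, Y⟩ h ⟨k', X', Y'⟩ h' heq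
    simp only [Finset.coe_sigma, Set.mem_sigma_iff, Finset.mem_coe, Finset.mem_filter,
      Finset.mem_product, mem_words, Finset.mem_range] at h h'
    simp only [Prod.mk.injEq] at heq
    obtain ⟨hk, ⟨hX, hY⟩, hu, hv⟩ := h
    obtain ⟨hk', ⟨hX', hY'⟩, hu', hv'⟩ := h'
    have l1 := IsAscending.length_le heq.1 hv hu'
    have l2 := IsAscending.length_le heq.1.symm hv' hu
    rw [List.length_take, List.length_take] at l1 l2
    obtain rfl : k = k' := by omega
    obtain ⟨e1, e2⟩ := List.append_inj heq.1 (by simp; omega)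
    obtain ⟨e3, e4⟩ := List.append_inj heq.2 (by simp; omega)
    have eX : X = X' := by rw [← List.take_append_drop k X, e1, e4, List.take_append_drop]
    have eY : Y = Y' := by rw [← List.take_append_drop k Y, e2, e3, List.take_append_drop]
    rw [eX, eY]

theorem exists_card_exists_hit_lt {ε : ℝ} (hε : 0 < ε) : ∃ N : ℕ,
    (((words N ×ˢ words N).filter fun p =>
      ∃ k ≤ N, Hit IsAscending IsLow p.1 p.2 k).card : ℝ) < ε * 4 ^ N := by
  obtain ⟨M, hM⟩ := ((Filter.tendsto_add_atTop_iff_nat 1).2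
    tendsto_sum_wordCount_mul).eventually_gt_atTop (2 / ε) |>.exists
  refine ⟨2 * M, ?_⟩
  have h1 := card_exists_hit_mul_le_two_mul (U := IsAscending) (V := IsLow)
    (fun _ _ => IsAscending.append) (fun _ _ => IsAscending.of_append)
    (fun _ _ => IsLow.append) (fun _ _ => IsLow.of_append) M
  have h2 : ∑ k ∈ Finset.range (2 * M + 1), (((words (2 * M) ×ˢ words (2 * M)).filter
      fun p => Hit IsAscending IsLow p.1 p.2 k).card : ℝ) ≤ 4 ^ (2 * M) := by
    exact_mod_cast sum_card_hit_le (2 * M)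
  set L := ∑ j ∈ Finset.range (M + 1),
    (wordCount IsAscending j / 2 ^ j : ℝ) * (wordCount IsLow j / 2 ^ j) with hL
  rw [div_lt_iff₀ hε] at hM
  have hL0 : 0 < L := by
    by_contra h
    nlinarith
  have h4 : (0 : ℝ) < 4 ^ (2 * M) := by positivity
  refine lt_of_mul_lt_mul_right ?_ hL0.le
  nlinarith

/-- The natural number with the given binary expansion, most significant digit first. -/
def binVal : List Bool → ℕ
  | [] => 0
  | b :: l => b.toNat * 2 ^ l.length + binVal l

theorem binVal_append (p s : List Bool) : binVal (p ++ s) = binVal p * 2 ^ s.length + binVal s := by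
  induction p with
  | nil => simp [binVal]
  | cons b p ih =>
    rw [List.cons_append, binVal, binVal, ih, List.length_append]
    ring

theorem binVal_lt (l : List Bool) : binVal l < 2 ^ l.length := by
  induction l with
  | nil => simp [binVal]
  | cons b l ih =>
    rw [binVal, List.length_cons, pow_succ]
    cases b <;> simp <;> omega

theorem exists_binVal_eq {n j : ℕ} (hj : j < 2 ^ n) :
    ∃ l : List Bool, l.length = n ∧ binVal l = j := by
  induction n generalizing j with
  | zero => exact ⟨[], rfl, by simp [binVal] at *; omega⟩
  | succ n ih =>
    rw [pow_succ] at hj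
    rcases lt_or_ge j (2 ^ n) with h | h
    · obtain ⟨l, hl, hv⟩ := ih h
      exact ⟨false :: l, by simp [hl], by simp [binVal, hv]⟩
    · obtain ⟨l, hl, hv⟩ := ih (j := j - 2 ^ n) (by omega)
      exact ⟨true :: l, by simp [hl], by simp [binVal, hv, hl]; omega⟩

theorem eq_of_binVal_eq {l m : List Bool} (hlen : l.length = m.length) (h : binVal l = binVal m) :
    l = m := by
  induction l generalizing m with
  | nil => exact (List.length_eq_zero_iff.1 hlen.symm).symm
  | cons b l ih =>
    rcases m with _ | ⟨c, m⟩
    · simp at hlen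
    · simp only [List.length_cons, Nat.add_right_cancel_iff] at hlen
      have h1 := binVal_lt l
      have h2 := binVal_lt m
      rw [binVal, binVal, hlen] at h
      rw [hlen] at h1
      cases b <;> cases c <;> simp at h ⊢
      · exact ih hlen h
      · omega
      · omega
      · exact ih hlen h

/-- The dyadic interval of points whose binary expansion starts with `l`. -/
def dyadicInterval (l : List Bool) : Set ℝ :=
  Set.Ico ((binVal l : ℝ) / 2 ^ l.length) ((binVal l + 1 : ℝ) / 2 ^ l.length)

theorem mem_dyadicInterval {l : List Bool} {t : ℝ} :
    t ∈ dyadicInterval l ↔ ⌊t * 2 ^ l.length⌋ = (binVal l : ℤ) := by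
  rw [dyadicInterval, Set.mem_Ico, Int.floor_eq_iff, div_le_iff₀ (by positivity),
    lt_div_iff₀ (by positivity), Int.cast_natCast]

theorem eq_of_mem_dyadicInterval {l m : List Bool} (hlen : l.length = m.length) {t : ℝ}
    (hl : t ∈ dyadicInterval l) (hm : t ∈ dyadicInterval m) : l = m := by
  rw [mem_dyadicInterval] at hl hm
  rw [hlen, hm] at hl
  exact eq_of_binVal_eq hlen (by exact_mod_cast hl.symm)

theorem dyadicInterval_append_subset (p s : List Bool) :
    dyadicInterval (p ++ s) ⊆ dyadicInterval p := by
  have h : (binVal s : ℝ) + 1 ≤ 2 ^ s.length := by exact_mod_cast binVal_lt s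
  rw [dyadicInterval, dyadicInterval, binVal_append, List.length_append, pow_add]
  apply Set.Ico_subset_Ico
  · rw [div_le_div_iff₀ (by positivity) (by positivity)]
    push_cast
    have : (0 : ℝ) ≤ binVal s * 2 ^ p.length := by positivity
    linarith
  · rw [div_le_div_iff₀ (by positivity) (by positivity)]
    push_cast
    have : (0 : ℝ) < 2 ^ p.length := by positivity
    nlinarith

theorem left_mem_dyadicInterval (l : List Bool) :
    (binVal l : ℝ) / 2 ^ l.length ∈ dyadicInterval l := by
  refine Set.left_mem_Ico.2 ?_
  gcongr
  linarith

theorem volume_dyadicInterval (l : List Bool) :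
    volume (dyadicInterval l) = ENNReal.ofReal (1 / 2 ^ l.length) := by
  rw [dyadicInterval, Real.volume_Ico]
  congr 1
  ring

theorem prefix_of_dyadicInterval_subset {l p : List Bool}
    (h : dyadicInterval l ⊆ dyadicInterval p) : p <+: l := by
  have hlen : p.length ≤ l.length := by
    have := measure_mono (μ := volume) h
    rw [volume_dyadicInterval, volume_dyadicInterval,
      ENNReal.ofReal_le_ofReal_iff (by positivity),
      one_div_le_one_div (by positivity) (by positivity)] at this
    exact (pow_le_pow_iff_right₀ (by norm_num)).1 this
  have h1 : (binVal l : ℝ) / 2 ^ l.length ∈ dyadicInterval (l.take p.length) := by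
    apply dyadicInterval_append_subset (l.take p.length) (l.drop p.length)
    rw [List.take_append_drop]
    exact left_mem_dyadicInterval l
  rw [← eq_of_mem_dyadicInterval (by simp; omega) h1 (h (left_mem_dyadicInterval l))]
  exact List.take_prefix _ _

theorem exists_mem_dyadicInterval {t : ℝ} {l : List Bool} (ht : t ∈ dyadicInterval l) (n : ℕ) :
    ∃ m : List Bool, m.length = n ∧ t ∈ dyadicInterval m := by
  have ht' : t ∈ dyadicInterval [] := dyadicInterval_append_subset [] l ht
  simp only [dyadicInterval, binVal, List.length_nil, Set.mem_Ico] at ht'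
  norm_num at ht'
  have h0 : 0 ≤ t * 2 ^ n := mul_nonneg ht'.1 (by positivity)
  have hlt : ⌊t * 2 ^ n⌋₊ < 2 ^ n := by
    rw [Nat.floor_lt h0]
    push_cast
    have : (0 : ℝ) < 2 ^ n := by positivity
    nlinarith
  obtain ⟨m, hm, hv⟩ := exists_binVal_eq hlt
  refine ⟨m, hm, ?_⟩
  rw [mem_dyadicInterval, hm, hv, Int.natCast_floor_eq_floor h0]

theorem isDyadicRect_iff {R : Set (ℝ × ℝ)} :
    IsDyadicRect R ↔ ∃ p q, R = dyadicInterval p ×ˢ dyadicInterval q := by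
  constructor
  · rintro ⟨N₁, j₁, N₂, j₂, h₁, h₂, rfl⟩
    obtain ⟨p, rfl, rfl⟩ := exists_binVal_eq h₁
    obtain ⟨q, rfl, rfl⟩ := exists_binVal_eq h₂
    exact ⟨p, q, rfl⟩
  · rintro ⟨p, q, rfl⟩
    exact ⟨_, _, _, _, binVal_lt p, binVal_lt q, rfl⟩

theorem volume_dyadicInterval_prod (p q : List Bool) :
    volume (dyadicInterval p ×ˢ dyadicInterval q) =
      ENNReal.ofReal (1 / 2 ^ (p.length + q.length)) := by
  rw [Measure.volume_eq_prod, Measure.prod_prod, volume_dyadicInterval, volume_dyadicInterval,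
    ← ENNReal.ofReal_mul (by positivity), pow_add, one_div_mul_one_div]

theorem prefix_of_prod_subset {u v p q : List Bool}
    (h : dyadicInterval u ×ˢ dyadicInterval v ⊆ dyadicInterval p ×ˢ dyadicInterval q) :
    p <+: u ∧ q <+: v := by
  rcases Set.prod_subset_prod_iff.1 h with h | h | h
  · exact ⟨prefix_of_dyadicInterval_subset h.1, prefix_of_dyadicInterval_subset h.2⟩
  · exact absurd h (Set.nonempty_iff_ne_empty.1 ⟨_, left_mem_dyadicInterval u⟩)
  · exact absurd h (Set.nonempty_iff_ne_empty.1 ⟨_, left_mem_dyadicInterval v⟩)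

/-- The rectangle cut out by the factorization `w = u ++ v`. -/
def cutRect (u v : List Bool) : Set (ℝ × ℝ) := dyadicInterval u ×ˢ dyadicInterval v.reverse

theorem volume_cutRect (u v : List Bool) :
    volume (cutRect u v) = ENNReal.ofReal (1 / 2 ^ (u ++ v).length) := by
  rw [cutRect, volume_dyadicInterval_prod, List.length_reverse, List.length_append]

theorem cutRect_inj {u v u' v' : List Bool} (h : cutRect u v = cutRect u' v') :
    u = u' ∧ v = v' := by
  have h1 := prefix_of_prod_subset h.le
  have h2 := prefix_of_prod_subset h.ge
  exact ⟨h2.1.eq_of_length_le h1.1.length_le,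
    List.reverse_injective (h2.2.eq_of_length_le h1.2.length_le)⟩

theorem card_filter_prefix_suffix_mul_le (N : ℕ) (p q : List Bool) :
    ((words N).filter fun w => ∃ m, w = p ++ m ++ q).card * 2 ^ (p.length + q.length) ≤ 2 ^ N := by
  rcases le_or_gt (p.length + q.length) N with h | h
  · have hsub : (words N).filter (fun w => ∃ m, w = p ++ m ++ q) ⊆
        (words (N - (p.length + q.length))).image fun m => p ++ m ++ q := by
      intro w hw
      rw [Finset.mem_filter, mem_words] at hw
      obtain ⟨hw, m, rfl⟩ := hw
      simp only [List.length_append] at hw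
      exact Finset.mem_image.2 ⟨m, mem_words.2 (by omega), rfl⟩
    have := (Finset.card_le_card hsub).trans Finset.card_image_le
    rw [card_words] at this
    calc _ ≤ 2 ^ (N - (p.length + q.length)) * 2 ^ (p.length + q.length) := by gcongr
      _ = 2 ^ N := by rw [← pow_add]; congr 1; omega
  · rw [Finset.filter_false_of_mem]
    · simp
    · rintro w hw ⟨m, rfl⟩
      rw [mem_words] at hw
      simp only [List.length_append] at hw
      omega

theorem cutRect_subset_biUnion_hit {U V : List Bool → Prop} {u v : List Bool} (hu : U u)
    (hv : V v) : cutRect u v ⊆ ⋃ p ∈ (words (u ++ v).length ×ˢ words (u ++ v).length).filter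
      (fun p => ∃ k ≤ (u ++ v).length, Hit U V p.1 p.2 k), cutRect p.1 p.2 := by
  rintro ⟨s, t⟩ ⟨hs, ht⟩
  obtain ⟨X, hX, hsX⟩ := exists_mem_dyadicInterval hs (u ++ v).length
  obtain ⟨y, hy, hty⟩ := exists_mem_dyadicInterval ht (u ++ v).length
  rw [List.length_append] at hX hy
  have eX : X.take u.length = u := by
    refine eq_of_mem_dyadicInterval (by simp; omega) (dyadicInterval_append_subset _
      (X.drop u.length) ?_) hs
    rwa [List.take_append_drop]
  have ey : y.take v.length = v.reverse := by
    refine eq_of_mem_dyadicInterval (by simp; omega) (dyadicInterval_append_subset _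
      (y.drop v.length) ?_) ht
    rwa [List.take_append_drop]
  refine Set.mem_biUnion (x := (X, y.reverse)) ?_ ⟨hsX, by simpa using hty⟩
  simp only [Finset.coe_filter, Finset.mem_product, mem_words, List.length_append,
    List.length_reverse, Set.mem_ofPred_eq]
  refine ⟨⟨hX, hy⟩, u.length, by omega, ?_, ?_⟩
  · rwa [eX]
  · rwa [List.drop_reverse, hy, Nat.add_sub_cancel_left, ey, List.reverse_reverse]

/-- (Carleson) For every `ε > 0` there is an equiareal quilt of total area `< ε`:
a finite collection `𝓡` of distinct dyadic rectangles in `[0,1)²`, all of the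
same area, with `∑_{R ∈ 𝓡} |R| = 1`, `∑_{R ∈ 𝓡, R ⊆ Q} |R| ≤ |Q|` for every
dyadic rectangle `Q`, and `|⋃ 𝓡| < ε`. -/
theorem statement13 (ε : ℝ) (hε : 0 < ε) :
    ∃ 𝓡 : Finset (Set (ℝ × ℝ)),
      (∀ R ∈ 𝓡, IsDyadicRect R) ∧
      (∃ A : ℝ≥0∞, ∀ R ∈ 𝓡, volume R = A) ∧
      (∑ R ∈ 𝓡, volume R = 1) ∧
      (∀ Q : Set (ℝ × ℝ), IsDyadicRect Q →
        ∑ R ∈ 𝓡 with R ⊆ Q, volume R ≤ volume Q) ∧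
      volume (⋃₀ (𝓡 : Set (Set (ℝ × ℝ)))) < ENNReal.ofReal ε := by
  obtain ⟨N, hN⟩ := exists_card_exists_hit_lt hε
  choose u v hw hu hv using exists_isAscending_isLow
  have hlen : ∀ w ∈ words N, (u w ++ v w).length = N := fun w h => by
    rw [← hw]; exact mem_words.1 h
  have hvol : ∀ w ∈ words N, volume (cutRect (u w) (v w)) = ENNReal.ofReal (1 / 2 ^ N) :=
    fun w h => by rw [volume_cutRect, hlen w h]
  have hinj : Function.Injective fun w => cutRect (u w) (v w) := fun w w' h => by
    obtain ⟨h1, h2⟩ := cutRect_inj h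
    rw [hw w, hw w', h1, h2]
  refine ⟨(words N).image fun w => cutRect (u w) (v w), ?_, ⟨ENNReal.ofReal (1 / 2 ^ N), ?_⟩,
    ?_, ?_, ?_⟩
  · simp only [Finset.forall_mem_image]
    exact fun w _ => isDyadicRect_iff.2 ⟨_, _, rfl⟩
  · simpa only [Finset.forall_mem_image] using hvol
  · rw [Finset.sum_image hinj.injOn, Finset.sum_congr rfl hvol, Finset.sum_const, card_words,
      ← ENNReal.ofReal_nsmul]
    simp
  · intro Q hQ
    obtain ⟨p, q, rfl⟩ := isDyadicRect_iff.1 hQ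
    rw [Finset.filter_image, Finset.sum_image hinj.injOn,
      Finset.sum_congr rfl fun w h => hvol w (Finset.mem_filter.1 h).1, Finset.sum_const,
      ← ENNReal.ofReal_nsmul, volume_dyadicInterval_prod]
    apply ENNReal.ofReal_le_ofReal
    have hsub : (words N).filter
        (fun w => cutRect (u w) (v w) ⊆ dyadicInterval p ×ˢ dyadicInterval q) ⊆
        (words N).filter fun w => ∃ m, w = p ++ m ++ q.reverse := by
      intro w h
      rw [Finset.mem_filter] at h ⊢
      obtain ⟨⟨a, ha⟩, ⟨b, hb⟩⟩ := prefix_of_prod_subset h.2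
      refine ⟨h.1, a ++ b.reverse, ?_⟩
      conv_lhs => rw [hw w, ← ha, ← List.reverse_reverse (v w), ← hb]
      simp
    have h1 := card_filter_prefix_suffix_mul_le N p q.reverse
    rw [List.length_reverse] at h1
    have h2 := (Nat.mul_le_mul_right (2 ^ (p.length + q.length)) (Finset.card_le_card hsub)).trans h1
    rw [nsmul_eq_mul, mul_one_div, div_le_div_iff₀ (by positivity) (by positivity), one_mul]
    exact_mod_cast h2
  · have hsub : ⋃₀ (((words N).image fun w => cutRect (u w) (v w) : Finset (Set (ℝ × ℝ))) :
        Set (Set (ℝ × ℝ))) ⊆ ⋃ p ∈ (words N ×ˢ words N).filter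
          (fun p => ∃ k ≤ N, Hit IsAscending IsLow p.1 p.2 k), cutRect p.1 p.2 := by
      refine Set.sUnion_subset fun R hR => ?_
      obtain ⟨w, h, rfl⟩ := Finset.mem_image.1 (Finset.mem_coe.1 hR)
      have := cutRect_subset_biUnion_hit (hu w) (hv w)
      rwa [hlen w h] at this
    refine (measure_mono hsub).trans_lt ((measure_biUnion_finset_le _ _).trans_lt ?_)
    have hvol' : ∀ p ∈ (words N ×ˢ words N).filter
        (fun p => ∃ k ≤ N, Hit IsAscending IsLow p.1 p.2 k),
        volume (cutRect p.1 p.2) = ENNReal.ofReal (1 / 4 ^ N) := by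
      intro p hp
      simp only [Finset.mem_filter, Finset.mem_product, mem_words] at hp
      rw [volume_cutRect, List.length_append, hp.1.1, hp.1.2, ← two_mul, pow_mul]
      norm_num
    rw [Finset.sum_congr rfl hvol', Finset.sum_const, ← ENNReal.ofReal_nsmul,
      ENNReal.ofReal_lt_ofReal_iff hε, nsmul_eq_mul, mul_one_div, div_lt_iff₀ (by positivity)]
    exact hN
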